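/- arXiv:2201.11537 — 2 statements merged into one kernel-verified Lean document; each statement's English description precedes it below -/
import Mathlib

section
/- Let a < b be reals and let p : [a,b] → [1,∞) be Lebesgue integrable. Then WBV_{p(·)}[a,b] is not separable with respect to the Luxemburg norm: there is no countable set D ⊆ WBV_{p(·)}[a,b] such that for every f ∈ WBV_{p(·)}[a,b] and every ε > 0 there exists g ∈ D with ‖f − g‖ < ε. -/
open MeasureTheory Set Filter
open scoped ENNReal

/-- The harmonic mean exponent `p̄([u,v]) = ((v-u)⁻¹ ∫_u^v 1/p)⁻¹`. -/
noncomputable def pbar (p : ℝ → ℝ) (u v : ℝ) : ℝ :=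
  ((v - u)⁻¹ * ∫ t in u..v, (p t)⁻¹)⁻¹

/-- `t 0 = c < t 1 < ⋯ < t n = d` is a partition of `[c,d]`. -/
def IsPartition (c d : ℝ) (n : ℕ) (t : ℕ → ℝ) : Prop :=
  0 < n ∧ t 0 = c ∧ t n = d ∧ ∀ k < n, t k < t (k + 1)

/-- The Wiener variable-exponent variation `V_c^d(p, f)`, valued in `[0,∞]`. -/
noncomputable def wienerVar (p f : ℝ → ℝ) (c d : ℝ) : ℝ≥0∞ :=
  ⨆ (n : ℕ) (t : ℕ → ℝ) (_ : IsPartition c d n t),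
    ENNReal.ofReal (∑ k ∈ Finset.range n,
      |f (t (k + 1)) - f (t k)| ^ pbar p (t k) (t (k + 1)))

/-- The Luxemburg norm `inf {λ > 0 : V_a^b(p, f/λ) ≤ 1}`, valued in `[0,∞]`. -/
noncomputable def luxNorm (p f : ℝ → ℝ) (a b : ℝ) : ℝ≥0∞ :=
  ⨅ (l : ℝ) (_ : 0 < l) (_ : wienerVar p (fun x => f x / l) a b ≤ 1),
    ENNReal.ofReal l

/-- Membership in the space `WBV_{p(·)}[a,b]`. -/
def MemWBV (p f : ℝ → ℝ) (a b : ℝ) : Prop :=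
  f a = 0 ∧ luxNorm p f a b < ⊤


theorem IsPartition.mem_Icc {c d : ℝ} {n : ℕ} {t : ℕ → ℝ} (h : IsPartition c d n t) {k : ℕ}
    (hk : k ≤ n) : t k ∈ Icc c d := by
  obtain ⟨-, h0, hn, hlt⟩ := h
  constructor
  · induction k with
    | zero => exact h0.ge
    | succ k ih => exact (ih (by lia)).trans (hlt k (by lia)).le
  · induction hk using Nat.decreasingInduction with
    | self => exact hn.le
    | of_succ k hk ih => exact (hlt k hk).le.trans ih

theorem pbar_pos {a b : ℝ} {p : ℝ → ℝ} (hp1 : ∀ x ∈ Icc a b, 1 ≤ p x)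
    (hpint : IntegrableOn p (Icc a b)) {u v : ℝ} (hu : a ≤ u) (huv : u < v) (hv : v ≤ b) :
    0 < pbar p u v := by
  have hsub : Ioc u v ⊆ Icc a b := fun x hx => ⟨hu.trans hx.1.le, hx.2.trans hv⟩
  have hint : IntervalIntegrable (fun t => (p t)⁻¹) volume u v := by
    rw [intervalIntegrable_iff_integrableOn_Ioc_of_le huv.le]
    have hm : AEMeasurable p (volume.restrict (Ioc u v)) :=
      (hpint.mono_set hsub).aestronglyMeasurable.aemeasurable
    refine Integrable.of_bound hm.inv.aestronglyMeasurable 1 ?_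
    filter_upwards [ae_restrict_mem measurableSet_Ioc] with x hx
    have h1 := hp1 x (hsub hx)
    rw [norm_inv, Real.norm_of_nonneg (by linarith)]
    exact inv_le_one_of_one_le₀ h1
  have hpos : 0 < ∫ t in u..v, (p t)⁻¹ :=
    intervalIntegral.intervalIntegral_pos_of_pos_on hint
      (fun x hx => inv_pos.2 (by linarith [hp1 x (hsub (Ioo_subset_Ioc_self hx))])) huv
  have : 0 < v - u := sub_pos.2 huv
  unfold pbar
  positivity

/-- The unit step function jumping just to the right of `x` lies in `WBV_{p(·)}[a,b]`. -/
theorem memWBV_indicator_Ioi {a b : ℝ} {p : ℝ → ℝ} (hp1 : ∀ x ∈ Icc a b, 1 ≤ p x)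
    (hpint : IntegrableOn p (Icc a b)) {x : ℝ} (hx : a < x) :
    MemWBV p ((Ioi x).indicator 1) a b := by
  refine ⟨by simp [hx.le], lt_of_le_of_lt ?_ (ENNReal.ofReal_lt_top (r := 1))⟩
  refine iInf₂_le_of_le 1 one_pos (iInf_le_of_le ?_ le_rfl)
  refine iSup_le fun n => iSup₂_le fun t ht => ?_
  rw [← ENNReal.ofReal_one]
  refine ENNReal.ofReal_le_ofReal ?_
  set f : ℝ → ℝ := (Ioi x).indicator 1 with hf
  have hterm : ∀ k ∈ Finset.range n,
      |f (t (k + 1)) / 1 - f (t k) / 1| ^ pbar p (t k) (t (k + 1)) =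
        f (t (k + 1)) - f (t k) := by
    intro k hk
    rw [Finset.mem_range] at hk
    have hlt := ht.2.2.2 k hk
    have hp := pbar_pos hp1 hpint (ht.mem_Icc hk.le).1 hlt (ht.mem_Icc hk).2
    by_cases h1 : x < t k
    · simp [hf, h1, h1.trans hlt, hp.ne']
    · by_cases h2 : x < t (k + 1) <;> simp [hf, h1, h2, hp.ne']
  rw [Finset.sum_congr rfl hterm, Finset.sum_range_sub fun k => f (t k)]
  simp only [hf, indicator, Pi.one_apply]
  split_ifs <;> norm_num

/-- The Luxemburg norm controls the oscillation between the left endpoint and an interior point. -/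
theorem abs_sub_left_lt_of_luxNorm_lt {a b : ℝ} {p : ℝ → ℝ} (hp1 : ∀ x ∈ Icc a b, 1 ≤ p x)
    (hpint : IntegrableOn p (Icc a b)) {h : ℝ → ℝ} {ε : ℝ}
    (hε : luxNorm p h a b < ENNReal.ofReal ε) {y : ℝ} (hy : y ∈ Ioo a b) :
    |h y - h a| < ε := by
  simp only [luxNorm, iInf_lt_iff] at hε
  obtain ⟨l, hl, hV, hlε⟩ := hε
  refine lt_of_le_of_lt ?_ (ENNReal.ofReal_lt_ofReal_iff'.1 hlε).1
  let t : ℕ → ℝ := fun k => if k = 0 then a else if k = 1 then y else b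
  have ht : IsPartition a b 2 t := by
    refine ⟨two_pos, by simp [t], by simp [t], fun k hk => ?_⟩
    interval_cases k <;> simp [t, hy.1, hy.2]
  have hsum := (le_iSup_of_le 2 (le_iSup₂_of_le t ht le_rfl)).trans hV
  rw [← ENNReal.ofReal_one, ENNReal.ofReal_le_ofReal_iff zero_le_one,
    Finset.sum_range_succ, Finset.sum_range_one] at hsum
  have hfirst : |h y / l - h a / l| ^ pbar p a y ≤ 1 := by
    refine le_trans ?_ hsum
    have h1 : t 1 = y := by simp [t]
    have h0 : t 0 = a := by simp [t]
    simp only [zero_add, h0, h1]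
    exact le_add_of_nonneg_right (Real.rpow_nonneg (abs_nonneg _) _)
  have hle : |h y / l - h a / l| ≤ 1 := by
    by_contra! hgt
    exact hfirst.not_gt (Real.one_lt_rpow hgt (pbar_pos hp1 hpint le_rfl hy.1 hy.2.le))
  rwa [← sub_div, abs_div, abs_of_pos hl, div_le_one hl] at hle

/-- `WBV_{p(·)}[a,b]` is not separable. -/
theorem wbv_not_separable (a b : ℝ) (hab : a < b) (p : ℝ → ℝ)
    (hp1 : ∀ x ∈ Set.Icc a b, 1 ≤ p x)
    (hpint : MeasureTheory.IntegrableOn p (Set.Icc a b)) :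
    ¬ ∃ D : Set (ℝ → ℝ), D.Countable ∧ (∀ g ∈ D, MemWBV p g a b) ∧
      ∀ f : ℝ → ℝ, MemWBV p f a b → ∀ ε : ℝ, 0 < ε →
        ∃ g ∈ D, luxNorm p (fun x => f x - g x) a b < ENNReal.ofReal ε := by
  rintro ⟨D, hD, -, happrox⟩
  have hex : ∀ x : ℝ, ∃ g : ℝ → ℝ, x ∈ Ioo a b → g ∈ D ∧
      luxNorm p (fun y => (Ioi x).indicator 1 y - g y) a b < ENNReal.ofReal (1 / 2) := by
    intro x
    by_cases hx : x ∈ Ioo a b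
    · obtain ⟨g, hg⟩ := happrox _ (memWBV_indicator_Ioi hp1 hpint hx.1) (1 / 2) (by norm_num)
      exact ⟨g, fun _ => hg⟩
    · exact ⟨0, fun h => absurd h hx⟩
  choose G hG using hex
  have hne : ∀ x ∈ Ioo a b, ∀ y ∈ Ioo a b, x < y → G x ≠ G y := by
    intro x hx y hy hxy hxyG
    have h1 := abs_sub_left_lt_of_luxNorm_lt hp1 hpint (hG x hx).2 hy
    have h2 := abs_sub_left_lt_of_luxNorm_lt hp1 hpint (hG y hy).2 hy
    simp only [hxyG, indicator, mem_Ioi, hxy, hx.1.not_gt, hy.1.not_gt, lt_irrefl, if_true,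
      if_false, Pi.one_apply] at h1 h2
    rw [abs_lt] at h1 h2
    linarith
  have hinj : InjOn G (Ioo a b) := by
    intro x hx y hy hxyG
    by_contra hxy
    rcases lt_or_gt_of_ne hxy with h | h
    · exact hne x hx y hy h hxyG
    · exact hne y hy x hx h hxyG.symm
  have hcount : (Ioo a b).Countable :=
    MapsTo.countable_of_injOn (fun x hx => (hG x hx).1) hinj hD
  exact (Cardinal.Real.Ioo_countable_iff.1 hcount).not_gt hab
end

section
/- Let a < b be reals, let p : [a,b] → [1,∞) be measurable and bounded, and let f ∈ BV^{p(·)}[a,b]. Then for every x ∈ (a,b] the left-hand limit lim_{t→x⁻} f(t) exists and is finite, and for every x ∈ [a,b) the right-hand limit lim_{t→x⁺} f(t) exists and is finite; consequently every discontinuity of f is of the first kind. -/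
open MeasureTheory Set Filter
open scoped ENNReal

/-- The tagged variable-exponent variation `V^{p(·)}_{[a,b]}(f)`, valued in `[0,∞]`. -/
noncomputable def taggedVar (p f : ℝ → ℝ) (a b : ℝ) : ℝ≥0∞ :=
  ⨆ (n : ℕ) (t : ℕ → ℝ) (x : ℕ → ℝ)
    (_ : IsPartition a b n t ∧ ∀ k < n, x k ∈ Set.Icc (t k) (t (k + 1))),
    ENNReal.ofReal (∑ k ∈ Finset.range n,
      |f (t (k + 1)) - f (t k)| ^ p (x k))

/-- Membership in the space `BV^{p(·)}[a,b]`. -/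
def MemBV (p f : ℝ → ℝ) (a b : ℝ) : Prop :=
  f a = 0 ∧ taggedVar p f a b < ⊤

/-- Some partition of `[c, d]`, tagged at left endpoints, has variation sum at least `s`. -/
def HasLeftTaggedSum (p f : ℝ → ℝ) (c d s : ℝ) : Prop :=
  ∃ (n : ℕ) (t : ℕ → ℝ), IsPartition c d n t ∧
    s ≤ ∑ k ∈ Finset.range n, |f (t (k + 1)) - f (t k)| ^ p (t k)

theorem HasLeftTaggedSum.single (p f : ℝ → ℝ) {c d : ℝ} (h : c < d) :
    HasLeftTaggedSum p f c d 0 := by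
  refine ⟨1, fun k => if k = 0 then c else d, ⟨one_pos, by simp, by simp, ?_⟩, ?_⟩
  · intro k hk
    obtain rfl : k = 0 := by omega
    simpa using h
  · exact Finset.sum_nonneg fun k _ => Real.rpow_nonneg (abs_nonneg _) _

theorem HasLeftTaggedSum.prepend {p f : ℝ → ℝ} {c e d s : ℝ} (hce : c < e)
    (h : HasLeftTaggedSum p f e d s) :
    HasLeftTaggedSum p f c d (s + |f e - f c| ^ p c) := by
  obtain ⟨n, t, ⟨hn, h0, hd, hlt⟩, hs⟩ := h
  refine ⟨n + 1, fun k => Nat.casesOn k c t, ⟨n.succ_pos, rfl, hd, ?_⟩, ?_⟩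
  · rintro (_ | k) hk
    · simpa [h0] using hce
    · exact hlt k (by omega)
  · rw [Finset.sum_range_succ']
    simpa [h0] using hs

theorem HasLeftTaggedSum.append {p f : ℝ → ℝ} {c e d s : ℝ}
    (h : HasLeftTaggedSum p f c e s) (hed : e < d) :
    HasLeftTaggedSum p f c d (s + |f d - f e| ^ p e) := by
  obtain ⟨n, t, ⟨hn, h0, he, hlt⟩, hs⟩ := h
  refine ⟨n + 1, fun k => if k ≤ n then t k else d,
    ⟨n.succ_pos, by simpa using h0, by simp, ?_⟩, ?_⟩
  · intro k hk
    rcases (Nat.lt_succ_iff.mp hk).lt_or_eq with hk | rfl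
    · simpa [hk.le, Nat.succ_le_of_lt hk] using hlt k hk
    · simpa [he] using hed
  · rw [Finset.sum_range_succ]
    have hsum : ∑ k ∈ Finset.range n, |f (if k + 1 ≤ n then t (k + 1) else d) -
        f (if k ≤ n then t k else d)| ^ p (if k ≤ n then t k else d) =
        ∑ k ∈ Finset.range n, |f (t (k + 1)) - f (t k)| ^ p (t k) := by
      refine Finset.sum_congr rfl fun k hk => ?_
      have hk := Finset.mem_range.mp hk
      simp [hk.le, Nat.succ_le_of_lt hk]
    simp only [hsum]
    simpa [he] using hs

theorem HasLeftTaggedSum.ofReal_le_taggedVar {p f : ℝ → ℝ} {a b s : ℝ}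
    (h : HasLeftTaggedSum p f a b s) : ENNReal.ofReal s ≤ taggedVar p f a b := by
  obtain ⟨n, t, ht, hs⟩ := h
  exact (ENNReal.ofReal_le_ofReal hs).trans <|
    le_iSup_of_le n <| le_iSup_of_le t <| le_iSup_of_le t <|
      le_iSup_of_le ⟨ht, fun k hk => ⟨le_rfl, (ht.2.2.2 k hk).le⟩⟩ le_rfl

theorem HasLeftTaggedSum.mono {p f : ℝ → ℝ} {c d s s' : ℝ}
    (h : HasLeftTaggedSum p f c d s) (hs : s' ≤ s) : HasLeftTaggedSum p f c d s' := by
  obtain ⟨n, t, ht, hst⟩ := h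
  exact ⟨n, t, ht, hs.trans hst⟩

theorem not_forall_hasLeftTaggedSum {p f : ℝ → ℝ} {a b δ : ℝ} (hδ : 0 < δ)
    (hf : taggedVar p f a b < ⊤) : ¬ ∀ m : ℕ, HasLeftTaggedSum p f a b (m * δ) := by
  intro h
  obtain ⟨m, hm⟩ := exists_nat_gt ((taggedVar p f a b).toReal / δ)
  have hle := (h m).ofReal_le_taggedVar
  rw [ENNReal.ofReal_le_iff_le_toReal hf.ne] at hle
  rw [div_lt_iff₀ hδ] at hm
  exact hm.not_ge hle

/-- A function without limit along a filter oscillates by a fixed amount on every set of it. -/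
theorem exists_oscillation_of_not_tendsto {f : ℝ → ℝ} {l : Filter ℝ} [l.NeBot]
    (h : ¬ ∃ L, Tendsto f l (nhds L)) :
    ∃ ε, 0 < ε ∧ ε ≤ 1 ∧ ∀ s ∈ l, ∃ u ∈ s, ∃ v ∈ s, u < v ∧ ε ≤ |f v - f u| := by
  have hc : ¬ Cauchy (map f l) := fun hc => h (CompleteSpace.complete hc)
  rw [Metric.cauchy_iff] at hc
  push Not at hc
  obtain ⟨ε, hε, hc⟩ := hc inferInstance
  refine ⟨min ε 1, lt_min hε one_pos, min_le_right _ _, fun s hs => ?_⟩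
  obtain ⟨_, ⟨u, hu, rfl⟩, _, ⟨v, hv, rfl⟩, huv⟩ := hc _ (image_mem_map hs)
  rw [Real.dist_eq] at huv
  have huv' := (min_le_left ε 1).trans huv
  rcases lt_trichotomy u v with hlt | rfl | hlt
  · exact ⟨u, hu, v, hv, hlt, by rwa [abs_sub_comm]⟩
  · simp only [sub_self, abs_zero] at huv
    exact absurd huv hε.not_ge
  · exact ⟨v, hv, u, hu, hlt, huv'⟩

theorem rpow_le_rpow_of_base_le_of_exponent_ge {ε y q M : ℝ} (hε : 0 < ε) (hε1 : ε ≤ 1)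
    (hy : ε ≤ y) (hq : 0 ≤ q) (hqM : q ≤ M) : ε ^ M ≤ y ^ q :=
  (Real.rpow_le_rpow_of_exponent_ge hε hε1 hqM).trans (Real.rpow_le_rpow hε.le hy hq)

theorem MemBV.exists_tendsto_left {p f : ℝ → ℝ} {a b M x : ℝ} (hf : MemBV p f a b)
    (hp1 : ∀ x ∈ Icc a b, 1 ≤ p x) (hM : ∀ x ∈ Icc a b, p x ≤ M) (hx : x ∈ Ioc a b) :
    ∃ L, Tendsto f (nhdsWithin x (Ico a x)) (nhds L) := by
  rw [nhdsWithin_Ico_eq_nhdsLT hx.1]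
  by_contra h
  obtain ⟨ε, hε, hε1, hosc⟩ := exists_oscillation_of_not_tendsto h
  have key : ∀ m : ℕ, ∀ c ∈ Ico a x, HasLeftTaggedSum p f c b (m * ε ^ M) := by
    intro m
    induction m with
    | zero =>
      intro c hc
      simpa using HasLeftTaggedSum.single p f (hc.2.trans_le hx.2)
    | succ m ih =>
      intro c hc
      obtain ⟨u, hu, v, hv, huv, hfuv⟩ := hosc _ (Ioo_mem_nhdsLT hc.2)
      have hua : u ∈ Icc a b := ⟨hc.1.trans hu.1.le, hu.2.le.trans hx.2⟩
      refine (((ih v ⟨hc.1.trans hv.1.le, hv.2⟩).prepend huv).prepend hu.1).mono ?_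
      have hstep := rpow_le_rpow_of_base_le_of_exponent_ge hε hε1 hfuv
        (zero_le_one.trans (hp1 u hua)) (hM u hua)
      have hnonneg : 0 ≤ |f u - f c| ^ p c := Real.rpow_nonneg (abs_nonneg _) _
      push_cast
      linarith
  exact not_forall_hasLeftTaggedSum (Real.rpow_pos_of_pos hε M) hf.2
    fun m => key m a ⟨le_rfl, hx.1⟩

theorem MemBV.exists_tendsto_right {p f : ℝ → ℝ} {a b M x : ℝ} (hf : MemBV p f a b)
    (hp1 : ∀ x ∈ Icc a b, 1 ≤ p x) (hM : ∀ x ∈ Icc a b, p x ≤ M) (hx : x ∈ Ico a b) :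
    ∃ L, Tendsto f (nhdsWithin x (Ioc x b)) (nhds L) := by
  rw [nhdsWithin_Ioc_eq_nhdsGT hx.2]
  by_contra h
  obtain ⟨ε, hε, hε1, hosc⟩ := exists_oscillation_of_not_tendsto h
  have key : ∀ m : ℕ, ∀ d ∈ Ioc x b, HasLeftTaggedSum p f a d (m * ε ^ M) := by
    intro m
    induction m with
    | zero =>
      intro d hd
      simpa using HasLeftTaggedSum.single p f (hx.1.trans_lt hd.1)
    | succ m ih =>
      intro d hd
      obtain ⟨u, hu, v, hv, huv, hfuv⟩ := hosc _ (Ioo_mem_nhdsGT hd.1)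
      have hua : u ∈ Icc a b := ⟨hx.1.trans hu.1.le, hu.2.le.trans hd.2⟩
      refine (((ih u ⟨hu.1, hua.2⟩).append huv).append hv.2).mono ?_
      have hstep := rpow_le_rpow_of_base_le_of_exponent_ge hε hε1 hfuv
        (zero_le_one.trans (hp1 u hua)) (hM u hua)
      have hnonneg : 0 ≤ |f d - f v| ^ p v := Real.rpow_nonneg (abs_nonneg _) _
      push_cast
      linarith
  exact not_forall_hasLeftTaggedSum (Real.rpow_pos_of_pos hε M) hf.2
    fun m => key m b ⟨hx.2, le_rfl⟩

/-- every `f ∈ BV^{p(·)}[a,b]` (bounded measurable exponent) has finite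
one-sided limits everywhere; consequently each discontinuity is of the first kind. -/
theorem bv_one_sided_limits (a b : ℝ) (hab : a < b) (p : ℝ → ℝ)
    (hpm : Measurable p)
    (hp1 : ∀ x ∈ Set.Icc a b, 1 ≤ p x)
    (hpbd : ∃ M : ℝ, ∀ x ∈ Set.Icc a b, p x ≤ M)
    (f : ℝ → ℝ) (hf : MemBV p f a b) :
    (∀ x ∈ Set.Ioc a b, ∃ L : ℝ,
      Filter.Tendsto f (nhdsWithin x (Set.Ico a x)) (nhds L)) ∧
    (∀ x ∈ Set.Ico a b, ∃ L : ℝ,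
      Filter.Tendsto f (nhdsWithin x (Set.Ioc x b)) (nhds L)) ∧
    (∀ x ∈ Set.Icc a b, ¬ ContinuousWithinAt f (Set.Icc a b) x →
      ((x ∈ Set.Ioc a b → ∃ L : ℝ,
        Filter.Tendsto f (nhdsWithin x (Set.Ico a x)) (nhds L)) ∧
       (x ∈ Set.Ico a b → ∃ L : ℝ,
        Filter.Tendsto f (nhdsWithin x (Set.Ioc x b)) (nhds L)))) := by
  obtain ⟨M, hM⟩ := hpbd
  exact ⟨fun x hx => hf.exists_tendsto_left hp1 hM hx,
    fun x hx => hf.exists_tendsto_right hp1 hM hx,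
    fun x _ _ => ⟨hf.exists_tendsto_left hp1 hM, hf.exists_tendsto_right hp1 hM⟩⟩
end
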